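/- Suppose the partial sums s_n converge to s, that r_n = s − s_n ≠ 0 for all n, that lim_{n→∞} r_{n+1}/r_n = x, and that x ≠ 1. Then for every m ≥ 1 the condition lim_{n→∞} Σ_{k=0}^{mp−1} (M_{k+1}^{(m)}(n)/M^{(m)}(n)) · (a_{n+k}/r_n) = 1 is satisfied. -/

import Mathlib

open Filter Finset

/-- The Pochhammer symbol `(z)_n = z (z+1) ⋯ (z+n-1)` over `ℂ`. -/
noncomputable def poch (z : ℂ) (n : ℕ) : ℂ := (ascPochhammer ℂ n).eval z

/-- The terms `a_n = ([α]_n / [β]_n) · x^n` of the generalized hypergeometric series. -/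
noncomputable def term (p : ℕ) (α β : Fin p → ℂ) (x : ℂ) (n : ℕ) : ℂ :=
  ((∏ i, poch (α i) n) / (∏ i, poch (β i) n)) * x ^ n

/-- The partial sums `s_n = ∑_{j=0}^{n-1} a_j`. -/
noncomputable def psum (p : ℕ) (α β : Fin p → ℂ) (x : ℂ) (n : ℕ) : ℂ :=
  ∑ j ∈ Finset.range n, term p α β x j

/-- The coefficients `λ_j^{(m)}(n)`. -/
noncomputable def lam (p : ℕ) (α β : Fin p → ℂ) (x : ℂ) (m j n : ℕ) : ℂ :=
  ((m * p).choose j : ℂ) * (-x) ^ (m * p - j) *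
    ∏ i, (poch (α i + (n : ℂ) + (j : ℂ)) (m * p - j) * poch (β i + (n : ℂ) + (m : ℂ) - 1) j)

/-- `M_k^{(m)}(n) = ∑_{j=k}^{mp} λ_j^{(m)}(n)`; `M^{(m)}(n)` is the case `k = 0`. -/
noncomputable def Mk (p : ℕ) (α β : Fin p → ℂ) (x : ℂ) (m k n : ℕ) : ℂ :=
  ∑ j ∈ Finset.Icc k (m * p), lam p α β x m j n

/-- The transformation `Q_n^{(m)}`. -/
noncomputable def Qt (p : ℕ) (α β : Fin p → ℂ) (x : ℂ) (m n : ℕ) : ℂ :=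
  (∑ j ∈ Finset.range (m * p + 1), lam p α β x m j n * psum p α β x (n + j)) /
    Mk p α β x m 0 n

lemma poch_zero (z : ℂ) : poch z 0 = 1 := by simp [poch]

lemma poch_succ (z : ℂ) (k : ℕ) : poch z (k + 1) = poch z k * (z + k) :=
  ascPochhammer_succ_eval k z

lemma tendsto_add_natCast_div (c : ℂ) :
    Tendsto (fun n : ℕ => (c + n) / (n : ℂ)) atTop (nhds 1) := by
  have h : Tendsto (fun n : ℕ => c / (n : ℂ) + 1) atTop (nhds (0 + 1)) :=
    (tendsto_const_div_atTop_nhds_zero_nat c).add_const 1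
  rw [zero_add] at h
  refine h.congr' ?_
  filter_upwards [eventually_ne_atTop 0] with n hn
  have : (n : ℂ) ≠ 0 := Nat.cast_ne_zero.mpr hn
  field_simp

lemma tendsto_poch_div_pow (c : ℂ) (k : ℕ) :
    Tendsto (fun n : ℕ => poch (c + n) k / (n : ℂ) ^ k) atTop (nhds 1) := by
  induction k with
  | zero => simp [poch_zero]
  | succ k ih =>
    have h := ih.mul (tendsto_add_natCast_div (c + k))
    rw [one_mul] at h
    refine h.congr fun n => ?_
    rw [poch_succ, pow_succ, div_mul_div_comm, add_right_comm c]

lemma tendsto_lam_div_pow (p : ℕ) (α β : Fin p → ℂ) (x : ℂ) (m j : ℕ) (hj : j ≤ m * p) :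
    Tendsto (fun n : ℕ => lam p α β x m j n / ((n : ℂ) ^ (m * p)) ^ p) atTop
      (nhds (((m * p).choose j : ℂ) * (-x) ^ (m * p - j))) := by
  have h : Tendsto (fun n : ℕ => ∏ i : Fin p,
      ((poch (α i + j + n) (m * p - j) / (n : ℂ) ^ (m * p - j)) *
        (poch (β i + m - 1 + n) j / (n : ℂ) ^ j))) atTop (nhds (∏ _i : Fin p, (1 * 1 : ℂ))) :=
    tendsto_finsetProd _ fun i _ =>
      (tendsto_poch_div_pow _ _).mul (tendsto_poch_div_pow _ _)
  have h2 := h.const_mul (((m * p).choose j : ℂ) * (-x) ^ (m * p - j))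
  simp only [mul_one, Finset.prod_const_one] at h2
  refine h2.congr fun n => ?_
  have hpow : ((n : ℂ) ^ (m * p)) ^ p = ∏ _i : Fin p, ((n : ℂ) ^ (m * p - j) * (n : ℂ) ^ j) := by
    simp [← pow_add, Nat.sub_add_cancel hj]
  rw [lam, hpow, mul_div_assoc, ← Finset.prod_div_distrib]
  congr 1
  refine Finset.prod_congr rfl fun i _ => ?_
  rw [div_mul_div_comm, add_right_comm (α i), show β i + m - 1 + (n : ℂ) = β i + n + m - 1 by ring]

lemma Mk_zero_eq (p : ℕ) (α β : Fin p → ℂ) (x : ℂ) (m n : ℕ) :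
    Mk p α β x m 0 n = ∑ j ∈ Finset.range (m * p + 1), lam p α β x m j n := by
  rw [Mk, Nat.range_succ_eq_Icc_zero]

lemma sum_choose_mul_neg_pow (x : ℂ) (N : ℕ) :
    ∑ j ∈ Finset.range (N + 1), (N.choose j : ℂ) * (-x) ^ (N - j) = (1 - x) ^ N := by
  rw [sub_eq_add_neg, add_pow]
  exact Finset.sum_congr rfl fun j _ => by ring

lemma tendsto_Mk_zero_div_pow (p : ℕ) (α β : Fin p → ℂ) (x : ℂ) (m : ℕ) :
    Tendsto (fun n : ℕ => Mk p α β x m 0 n / ((n : ℂ) ^ (m * p)) ^ p) atTop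
      (nhds ((1 - x) ^ (m * p))) := by
  have h := tendsto_finsetSum (Finset.range (m * p + 1)) fun j hj =>
    tendsto_lam_div_pow p α β x m j (Finset.mem_range_succ_iff.mp hj)
  rw [sum_choose_mul_neg_pow] at h
  refine h.congr fun n => ?_
  rw [Mk_zero_eq, Finset.sum_div]

lemma tendsto_lam_div_Mk_zero (p : ℕ) (α β : Fin p → ℂ) (x : ℂ) (hx : x ≠ 1) (m j : ℕ)
    (hj : j ≤ m * p) :
    Tendsto (fun n : ℕ => lam p α β x m j n / Mk p α β x m 0 n) atTop
      (nhds (((m * p).choose j : ℂ) * (-x) ^ (m * p - j) / (1 - x) ^ (m * p))) := by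
  refine ((tendsto_lam_div_pow p α β x m j hj).div (tendsto_Mk_zero_div_pow p α β x m)
    (pow_ne_zero _ (sub_ne_zero.mpr hx.symm))).congr' ?_
  filter_upwards [eventually_ne_atTop 0] with n hn
  exact div_div_div_cancel_right₀
    (pow_ne_zero _ (pow_ne_zero _ (Nat.cast_ne_zero.mpr hn))) _ _

/-- Shifted ratios of a sequence with asymptotic ratio `x` tend to powers of `x`. -/
lemma tendsto_shift_ratio {r : ℕ → ℂ} {x : ℂ} (hr : ∀ n, r n ≠ 0)
    (h : Tendsto (fun n => r (n + 1) / r n) atTop (nhds x)) (j : ℕ) :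
    Tendsto (fun n => r (n + j) / r n) atTop (nhds (x ^ j)) := by
  induction j with
  | zero => simp [hr]
  | succ j ih =>
    rw [pow_succ']
    refine ((h.comp (tendsto_add_atTop_nat j)).mul ih).congr fun n => ?_
    exact div_mul_div_cancel₀ (hr (n + j))

/-- Summation by parts for tail sums of the coefficients. -/
lemma sum_Mk_succ_mul_term (p : ℕ) (α β : Fin p → ℂ) (x : ℂ) (m n : ℕ) :
    ∑ k ∈ Finset.range (m * p), Mk p α β x m (k + 1) n * term p α β x (n + k) =
      ∑ j ∈ Finset.range (m * p + 1),
        lam p α β x m j n * (psum p α β x (n + j) - psum p α β x n) := by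
  have hdiff (j : ℕ) : psum p α β x (n + j) - psum p α β x n =
      ∑ k ∈ Finset.range j, term p α β x (n + k) := by
    rw [psum, psum, Finset.sum_range_add, add_sub_cancel_left]
  simp only [hdiff, Mk, Finset.sum_mul, Finset.mul_sum]
  refine Finset.sum_comm' fun k j => ?_
  simp only [Finset.mem_range, Finset.mem_Icc]
  omega

/-- **Theorem 2 (condition).** If `s_n → s`, the remainders `r_n = s - s_n` are nonzero,
`r_{n+1}/r_n → x` and `x ≠ 1`, then for every `m ≥ 1`
`lim ∑_{k=0}^{mp-1} (M_{k+1}^{(m)}(n)/M^{(m)}(n)) · (a_{n+k}/r_n) = 1`. -/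
theorem condition_of_ratio_tendsto
    (p : ℕ) (hp : 1 ≤ p) (α β : Fin p → ℂ) (x : ℂ) (hx : x ≠ 1)
    (hβ : ∀ i, ∀ k : ℕ, β i ≠ -(k : ℂ))
    (s : ℂ) (hs : Filter.Tendsto (psum p α β x) Filter.atTop (nhds s))
    (hr : ∀ n, s - psum p α β x n ≠ 0)
    (hratio : Filter.Tendsto
      (fun n => (s - psum p α β x (n + 1)) / (s - psum p α β x n))
      Filter.atTop (nhds x))
    (m : ℕ) (hm : 1 ≤ m) :
    Filter.Tendsto
      (fun n => ∑ k ∈ Finset.range (m * p),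
        (Mk p α β x m (k + 1) n / Mk p α β x m 0 n) *
          (term p α β x (n + k) / (s - psum p α β x n)))
      Filter.atTop (nhds 1) := by
  set r : ℕ → ℂ := fun n => s - psum p α β x n with hrdef
  have hmp : m * p ≠ 0 := by positivity
  have hx' : (1 - x) ^ (m * p) ≠ 0 := pow_ne_zero _ (sub_ne_zero.mpr hx.symm)
  have hlim := tendsto_finsetSum (Finset.range (m * p + 1)) fun j hj =>
    (tendsto_lam_div_Mk_zero p α β x hx m j (Finset.mem_range_succ_iff.mp hj)).mul
      ((tendsto_shift_ratio (r := r) hr hratio j).const_sub 1)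
  have hzero : ∑ j ∈ Finset.range (m * p + 1),
      ((m * p).choose j : ℂ) * (-x) ^ (m * p - j) * x ^ j = 0 := by
    rw [← zero_pow (M₀ := ℂ) hmp, ← add_neg_cancel x, add_pow]
    exact Finset.sum_congr rfl fun j _ => by ring
  have hval : ∑ j ∈ Finset.range (m * p + 1),
      ((m * p).choose j : ℂ) * (-x) ^ (m * p - j) / (1 - x) ^ (m * p) * (1 - x ^ j) = 1 := by
    simp only [div_mul_eq_mul_div, mul_sub, mul_one]
    rw [Finset.sum_sub_distrib, ← Finset.sum_div, ← Finset.sum_div, sum_choose_mul_neg_pow, hzero,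
      zero_div, sub_zero, div_self hx']
  rw [hval] at hlim
  refine hlim.congr fun n => ?_
  have hrn : r n ≠ 0 := hr n
  simp only [div_mul_div_comm]
  rw [← Finset.sum_div, sum_Mk_succ_mul_term, Finset.sum_div]
  refine Finset.sum_congr rfl fun j _ => ?_
  rw [one_sub_div hrn, div_mul_div_comm]
  congr 2
  simp only [hrdef]
  ring
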